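/- Let Y and X be measurable spaces, ν a probability measure on Y, λ a σ-finite measure on X, and let κ and q be Markov kernels from Y to X with densities f(y,·) and g(y,·) with respect to λ for every y. Let μ = ν ⊗ κ and L(q) = −∫_{Y×X} log g(y,x) dμ(y,x), and assume log f and log g are μ-integrable. Then L(q) = L(κ) if and only if q(y) = κ(y) for ν-almost every y ∈ Y. Consequently, a global minimizer of the expected negative log-likelihood coincides ν-almost surely with the true posterior kernel, so sampling from a loss-minimizing model is exact Thompson sampling under the pretraining prior. -/

import Mathlib

open MeasureTheory ProbabilityTheory

/-- A `withDensity` measure gives full mass to the set where its density is positive. -/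
lemma ae_withDensity_ofReal_pos {X : Type*} [MeasurableSpace X] {lam : Measure X} {f : X → ℝ}
    (hf : Measurable f) :
    ∀ᵐ x ∂(lam.withDensity fun x => ENNReal.ofReal (f x)), 0 < f x := by
  rw [ae_withDensity_iff hf.ennreal_ofReal]
  filter_upwards with x hx
  simpa using hx

/-- The likelihood ratio of two densities has integral at most the mass of the numerator. -/
lemma lintegral_div_withDensity_ofReal_le {X : Type*} [MeasurableSpace X] {lam : Measure X}
    {f g : X → ℝ} (hf : Measurable f) (hg : Measurable g) (hf_nonneg : ∀ x, 0 ≤ f x)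
    (hg_nonneg : ∀ x, 0 ≤ g x) :
    ∫⁻ x, ENNReal.ofReal (g x / f x) ∂(lam.withDensity fun x => ENNReal.ofReal (f x)) ≤
      ∫⁻ x, ENNReal.ofReal (g x) ∂lam := by
  rw [lintegral_withDensity_eq_lintegral_mul _ hf.ennreal_ofReal
    (hg.fun_div hf).ennreal_ofReal]
  refine lintegral_mono fun x => ?_
  simp only [Pi.mul_apply]
  rw [← ENNReal.ofReal_mul (hf_nonneg x)]
  refine ENNReal.ofReal_le_ofReal ?_
  rcases (hf_nonneg x).eq_or_lt with h | h
  · simpa [← h] using hg_nonneg x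
  · exact (mul_div_cancel₀ (g x) h.ne').le

/-- Two probability densities that agree almost everywhere for the measure defined by the first
one define the same measure. -/
lemma withDensity_ofReal_eq_of_ae_eq {X : Type*} [MeasurableSpace X] {lam : Measure X}
    {f g : X → ℝ} (hf : Measurable f)
    [IsProbabilityMeasure (lam.withDensity fun x => ENNReal.ofReal (f x))]
    [IsProbabilityMeasure (lam.withDensity fun x => ENNReal.ofReal (g x))]
    (h : ∀ᵐ x ∂(lam.withDensity fun x => ENNReal.ofReal (f x)), g x = f x) :
    lam.withDensity (fun x => ENNReal.ofReal (g x)) =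
      lam.withDensity fun x => ENNReal.ofReal (f x) := by
  rw [ae_withDensity_iff hf.ennreal_ofReal] at h
  refine (Measure.eq_of_le_of_isProbabilityMeasure (withDensity_mono ?_)).symm
  filter_upwards [h] with x hx
  by_cases h0 : ENNReal.ofReal (f x) = 0
  · simp [h0]
  · rw [hx h0]

/-- Equality case of Gibbs' inequality: if the ratio `g / f` has integral at most one and `log g`
and `log f` have the same integral, then `g = f` almost everywhere. -/
lemma ae_eq_of_integral_log_eq {Ω : Type*} [MeasurableSpace Ω] {μ : Measure Ω}
    [IsProbabilityMeasure μ] {f g : Ω → ℝ} (hf : Measurable f) (hg : Measurable g)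
    (hf_pos : ∀ᵐ p ∂μ, 0 < f p) (hg_pos : ∀ᵐ p ∂μ, 0 < g p)
    (hlogf : Integrable (fun p => Real.log (f p)) μ)
    (hlogg : Integrable (fun p => Real.log (g p)) μ)
    (hratio : ∫⁻ p, ENNReal.ofReal (g p / f p) ∂μ ≤ 1)
    (heq : ∫ p, Real.log (g p) ∂μ = ∫ p, Real.log (f p) ∂μ) :
    g =ᵐ[μ] f := by
  have hr_nonneg : 0 ≤ᵐ[μ] fun p => g p / f p := by
    filter_upwards [hf_pos, hg_pos] with p h1 h2 using (div_pos h2 h1).le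
  have hr_meas : AEStronglyMeasurable (fun p => g p / f p) μ :=
    (hg.div hf).aestronglyMeasurable
  have hr_int : Integrable (fun p => g p / f p) μ :=
    (lintegral_ofReal_ne_top_iff_integrable hr_meas hr_nonneg).mp
      (hratio.trans_lt ENNReal.one_lt_top).ne
  have hr_le : ∫ p, g p / f p ∂μ ≤ 1 := by
    rw [integral_eq_lintegral_of_nonneg_ae hr_nonneg hr_meas]
    exact ENNReal.toReal_le_of_le_ofReal zero_le_one (by simpa using hratio)
  let gap : Ω → ℝ := fun p => g p / f p - 1 - (Real.log (g p) - Real.log (f p))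
  have hgap_int : Integrable gap μ := (hr_int.sub (integrable_const 1)).sub (hlogg.sub hlogf)
  have hgap_nonneg : 0 ≤ᵐ[μ] gap := by
    filter_upwards [hf_pos, hg_pos] with p h1 h2
    have := Real.log_le_sub_one_of_pos (div_pos h2 h1)
    rw [Real.log_div h2.ne' h1.ne'] at this
    exact sub_nonneg.mpr this
  have hgap_integral : ∫ p, gap p ∂μ = ∫ p, g p / f p ∂μ - 1 := by
    have h1 : ∫ p, gap p ∂μ = ∫ p, (g p / f p - 1) ∂μ -
        ∫ p, (Real.log (g p) - Real.log (f p)) ∂μ :=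
      integral_sub (hr_int.sub (integrable_const 1)) (hlogg.sub hlogf)
    rw [h1, integral_sub hr_int (integrable_const 1), integral_sub hlogg hlogf, heq]
    simp
  have hgap_zero : gap =ᵐ[μ] 0 :=
    (integral_eq_zero_iff_of_nonneg_ae hgap_nonneg hgap_int).mp
      (le_antisymm (by linarith) (integral_nonneg_of_ae hgap_nonneg))
  filter_upwards [hf_pos, hg_pos, hgap_zero] with p h1 h2 h3
  by_contra hne
  have hlt := Real.log_lt_sub_one_of_pos (div_pos h2 h1)
    (fun h => hne ((div_eq_one_iff_eq h1.ne').mp h))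
  rw [Real.log_div h2.ne' h1.ne'] at hlt
  simp only [gap, Pi.zero_apply] at h3
  linarith

/-- **Loss-minimizing models coincide a.s. with the true posterior kernel
(exact Thompson sampling).**

`Y` is the space of datasets `D`, `X` the input space, `ν` the law of datasets,
`lam` a σ-finite reference measure on `X`. The Markov kernels `κ` (the true
posterior over the optimum, `p(x_* | D)`, induced by the pretraining prior over
functions) and `q` (the model `p_θ(x_* | D)`) have densities `f y ·` and
`g y ·` with respect to `lam`. With `μ = ν ⊗ₘ κ` and the expected negative
log-likelihood loss `L(q) = -∫ log g dμ`, assuming `log f` and `log g` are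
`μ`-integrable (in particular `g` is positive `μ`-a.e., so that `log g` is
genuinely defined `μ`-a.e.), we have `L(q) = L(κ)` if and only if
`q y = κ y` for `ν`-almost every `y`. Consequently a global minimizer of the
loss equals the true posterior kernel `ν`-a.s., so sampling from it is exact
Thompson sampling under the pretraining prior. -/
theorem loss_eq_iff_ae_eq_true_kernel
    {Y X : Type*} [MeasurableSpace Y] [MeasurableSpace X]
    (ν : Measure Y) [IsProbabilityMeasure ν]
    (lam : Measure X) [SigmaFinite lam]
    (κ q : Kernel Y X) [IsMarkovKernel κ] [IsMarkovKernel q]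
    (f g : Y → X → ℝ)
    (hf_meas : Measurable (Function.uncurry f))
    (hg_meas : Measurable (Function.uncurry g))
    (hf_nonneg : ∀ y x, 0 ≤ f y x) (hg_nonneg : ∀ y x, 0 ≤ g y x)
    (hκ : ∀ y, κ y = lam.withDensity fun x => ENNReal.ofReal (f y x))
    (hq : ∀ y, q y = lam.withDensity fun x => ENNReal.ofReal (g y x))
    (hlogf : Integrable (fun p : Y × X => Real.log (f p.1 p.2)) (ν ⊗ₘ κ))
    (hlogg : Integrable (fun p : Y × X => Real.log (g p.1 p.2)) (ν ⊗ₘ κ))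
    (hg_pos : ∀ᵐ p : Y × X ∂(ν ⊗ₘ κ), 0 < g p.1 p.2) :
    (-∫ p : Y × X, Real.log (g p.1 p.2) ∂(ν ⊗ₘ κ) =
        -∫ p : Y × X, Real.log (f p.1 p.2) ∂(ν ⊗ₘ κ)) ↔
      (∀ᵐ y ∂ν, q y = κ y) := by
  have hf_sec (y : Y) : Measurable (f y) := hf_meas.of_uncurry_left
  have hg_sec (y : Y) : Measurable (g y) := hg_meas.of_uncurry_left
  rw [neg_inj]
  constructor
  · intro heq
    have hf_pos : ∀ᵐ p ∂(ν ⊗ₘ κ), 0 < Function.uncurry f p := by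
      refine Measure.ae_compProd_of_ae_ae (measurableSet_lt measurable_const hf_meas) ?_
      filter_upwards with y
      rw [hκ y]
      exact ae_withDensity_ofReal_pos (hf_sec y)
    have hratio : ∫⁻ p, ENNReal.ofReal (Function.uncurry g p / Function.uncurry f p)
        ∂(ν ⊗ₘ κ) ≤ 1 := by
      rw [Measure.lintegral_compProd (hg_meas.fun_div hf_meas).ennreal_ofReal]
      calc ∫⁻ y, ∫⁻ x, ENNReal.ofReal (g y x / f y x) ∂κ y ∂ν
          ≤ ∫⁻ _, 1 ∂ν := lintegral_mono fun y => by
            rw [hκ y]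
            refine (lintegral_div_withDensity_ofReal_le (hf_sec y) (hg_sec y) (hf_nonneg y)
              (hg_nonneg y)).trans_eq ?_
            rw [← setLIntegral_univ, ← withDensity_apply _ MeasurableSet.univ, ← hq y,
              measure_univ]
        _ = 1 := by simp
    have hgf : Function.uncurry g =ᵐ[ν ⊗ₘ κ] Function.uncurry f :=
      ae_eq_of_integral_log_eq hf_meas hg_meas hf_pos hg_pos hlogf hlogg hratio heq
    filter_upwards [Measure.ae_ae_of_ae_compProd hgf] with y hy
    have hκ_prob : IsProbabilityMeasure (κ y) := inferInstance
    have hq_prob : IsProbabilityMeasure (q y) := inferInstance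
    rw [hκ y] at hy hκ_prob
    rw [hq y] at hq_prob
    rw [hκ y, hq y]
    exact withDensity_ofReal_eq_of_ae_eq (hf_sec y) hy
  · intro h
    have hgf : Function.uncurry g =ᵐ[ν ⊗ₘ κ] Function.uncurry f := by
      refine Measure.ae_compProd_of_ae_ae (measurableSet_eq_fun hg_meas hf_meas) ?_
      filter_upwards [h] with y hy
      rw [hκ y, hq y, withDensity_eq_iff_of_sigmaFinite (hg_sec y).ennreal_ofReal.aemeasurable
        (hf_sec y).ennreal_ofReal.aemeasurable] at hy
      rw [hκ y]
      refine (withDensity_absolutelyContinuous _ _).ae_le ?_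
      filter_upwards [hy] with x hx
      exact (ENNReal.ofReal_eq_ofReal_iff (hg_nonneg y x) (hf_nonneg y x)).mp hx
    refine integral_congr_ae ?_
    filter_upwards [hgf] with p hp
    exact congrArg Real.log hp
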